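/- For every integer m ≥ 3, ESO(m,3) < m + (6m)^{1/3} + 3, where the inequality is between the natural number ESO(m,3) (viewed as a real number) and the real number m + (6m)^{1/3} + 3. -/

import Mathlib

open Set

/-- A point in the plane. -/
abbrev Pt : Type := ℝ × ℝ

/-- The point set `P` contains an `n`-up-run: `n` points with strictly increasing
`x`-coordinates and nondecreasing `y`-coordinates. -/
def HasUpRun (P : Set Pt) (n : ℕ) : Prop :=
  ∃ f : Fin n → Pt, (∀ i, f i ∈ P) ∧
    StrictMono (fun i => (f i).1) ∧ Monotone (fun i => (f i).2)

/-- The point set `P` contains an `n`-down-run: `n` points with strictly increasing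
`x`-coordinates and strictly decreasing `y`-coordinates. -/
def HasDownRun (P : Set Pt) (n : ℕ) : Prop :=
  ∃ f : Fin n → Pt, (∀ i, f i ∈ P) ∧
    StrictMono (fun i => (f i).1) ∧ StrictAnti (fun i => (f i).2)

/-- A strategy for player A: from the list of previously played points, choose
an x-coordinate. -/
abbrev AStrat : Type := List Pt → ℝ

/-- A strategy for player B: from the list of previously played points and the new
x-coordinate, choose a y-coordinate. -/
abbrev BStrat : Type := List Pt → ℝ → ℝ

/-- Validity of a strategy for player A in either game: the chosen x-coordinate lies in
`(0,1)` and is distinct from all previously played x-coordinates. -/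
def AValid (sA : AStrat) : Prop :=
  ∀ h : List Pt, sA h ∈ Ioo (0:ℝ) 1 ∧ ∀ p ∈ h, sA h ≠ p.1

/-- Validity of a strategy for player B in the game `A_{m,k}`: the chosen y-coordinate
lies in `(0,1)` and is distinct from all previously played y-coordinates. -/
def BValid (sB : BStrat) : Prop :=
  ∀ (h : List Pt) (x : ℝ), sB h x ∈ Ioo (0:ℝ) 1 ∧ ∀ p ∈ h, sB h x ≠ p.2

/-- The list of points played in the first `n` turns when A plays `sA` and B plays `sB`. -/
def hist (sA : AStrat) (sB : BStrat) : ℕ → List Pt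
  | 0 => []
  | n + 1 =>
      let h := hist sA sB n
      h ++ [(sA h, sB h (sA h))]

/-- The set of points played in the first `N` turns. -/
def played (sA : AStrat) (sB : BStrat) (N : ℕ) : Set Pt :=
  {p | p ∈ hist sA sB N}

/-- In the game `A_{m,k}`, strategy `sA` of player A is valid and guarantees an
`m`-up-run or a `k`-down-run among the first `N` points, against every valid
strategy of player B. -/
def AWinsBy (m k N : ℕ) (sA : AStrat) : Prop :=
  AValid sA ∧ ∀ sB : BStrat, BValid sB →
    HasUpRun (played sA sB N) m ∨ HasDownRun (played sA sB N) k

/-- The Erdős–Szekeres on-line number `ESO(m,k)`: the least `N` such that player A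
has a strategy forcing an `m`-up-run or a `k`-down-run within `N` turns. -/
noncomputable def ESO (m k : ℕ) : ℕ := sInf {N | ∃ sA : AStrat, AWinsBy m k N sA}

/-- Validity of a strategy for player B in the tier game `B_{m,k}`: the chosen
y-coordinate is an integer in `{1, …, k-1}` (repetitions allowed). -/
def BTierValid (k : ℕ) (sB : BStrat) : Prop :=
  ∀ (h : List Pt) (x : ℝ), ∃ j : ℕ, 1 ≤ j ∧ j ≤ k - 1 ∧ sB h x = (j : ℝ)

/-- In the tier game `B_{m,k}`, strategy `sA` of player A is valid and guarantees an
`m`-up-run among the first `N` points, against every valid strategy of player B. -/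
def AWinsTierBy (m k N : ℕ) (sA : AStrat) : Prop :=
  AValid sA ∧ ∀ sB : BStrat, BTierValid k sB → HasUpRun (played sA sB N) m

/-- `B(m,k)`: the least `N` such that player A has a strategy forcing an `m`-up-run
within `N` turns of the tier game `B_{m,k}`. -/
noncomputable def BNum (m k : ℕ) : ℕ := sInf {N | ∃ sA : AStrat, AWinsTierBy m k N sA}

/-- The goal of player A: an `m`-up-run or a `k`-down-run. -/
def RunGoal (m k : ℕ) (P : Set Pt) : Prop := HasUpRun P m ∨ HasDownRun P k

/-- From the position `P`, player A can reach `RunGoal m k` within `n` further turns. -/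
def Forces (m k : ℕ) : ℕ → Set Pt → Prop
  | 0, P => RunGoal m k P
  | n + 1, P => RunGoal m k P ∨ ∃ x ∈ Ioo (0 : ℝ) 1, (∀ p ∈ P, x ≠ p.1) ∧
      ∀ y ∈ Ioo (0 : ℝ) 1, (∀ p ∈ P, y ≠ p.2) → Forces m k n (insert (x, y) P)

theorem RunGoal.mono {m k : ℕ} {P Q : Set Pt} (h : RunGoal m k P) (hPQ : P ⊆ Q) :
    RunGoal m k Q := by
  rcases h with ⟨f, hf, h⟩ | ⟨f, hf, h⟩
  · exact Or.inl ⟨f, fun i => hPQ (hf i), h⟩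
  · exact Or.inr ⟨f, fun i => hPQ (hf i), h⟩

theorem RunGoal.forces {m k : ℕ} {P : Set Pt} (h : RunGoal m k P) (n : ℕ) : Forces m k n P := by
  cases n with
  | zero => exact h
  | succ n => exact Or.inl h

theorem exists_fresh {P : Set Pt} (hP : P.Finite) {a b : ℝ} (hab : a < b) :
    ∃ x ∈ Ioo a b, ∀ p ∈ P, x ≠ p.1 := by
  obtain ⟨x, hx, hxP⟩ := (Ioo_infinite hab).exists_notMem_finite (hP.image Prod.fst)
  exact ⟨x, hx, fun p hp h => hxP ⟨p, hp, h.symm⟩⟩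

theorem length_hist (sA : AStrat) (sB : BStrat) (n : ℕ) : (hist sA sB n).length = n := by
  induction n with
  | zero => rfl
  | succ n ih => simp [hist, ih]

theorem played_succ (sA : AStrat) (sB : BStrat) (n : ℕ) :
    played sA sB (n + 1) =
      insert (sA (hist sA sB n), sB (hist sA sB n) (sA (hist sA sB n))) (played sA sB n) := by
  ext p
  simp [played, hist, or_comm]

open Classical in
/-- A position-wise winning play yields a winning strategy. -/
theorem Forces.exists_strategy {m k N : ℕ} (h : Forces m k N ∅) :
    ∃ sA : AStrat, AWinsBy m k N sA := by
  let good (l : List Pt) (x : ℝ) : Prop := x ∈ Ioo (0 : ℝ) 1 ∧ (∀ p ∈ l, x ≠ p.1) ∧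
    ∀ y ∈ Ioo (0 : ℝ) 1, (∀ p ∈ l, y ≠ p.2) →
      Forces m k (N - (l.length + 1)) (insert (x, y) {p | p ∈ l})
  have fresh (l : List Pt) : ∃ x ∈ Ioo (0 : ℝ) 1, ∀ p ∈ l, x ≠ p.1 :=
    exists_fresh (P := {p | p ∈ l}) l.finite_toSet one_pos
  let sA : AStrat := fun l => if H : ∃ x, good l x then H.choose else (fresh l).choose
  have sA_good (l : List Pt) (H : ∃ x, good l x) : good l (sA l) := by
    simp only [sA, dif_pos H]
    exact H.choose_spec
  refine ⟨sA, fun l => ?_, fun sB hB => ?_⟩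
  · by_cases H : ∃ x, good l x
    · exact ⟨(sA_good l H).1, (sA_good l H).2.1⟩
    · simp only [sA, dif_neg H]
      exact (fresh l).choose_spec
  · have key : ∀ j ≤ N, Forces m k (N - j) (played sA sB j) := by
      intro j
      induction j with
      | zero =>
        intro _
        simpa [played, hist] using h
      | succ j ih =>
        intro hj
        have hF := ih (by omega)
        obtain ⟨d, hd⟩ : ∃ d, N - j = d + 1 := ⟨N - (j + 1), by omega⟩
        rw [hd] at hF
        have hd' : N - (j + 1) = d := by omega
        rw [played_succ]
        rcases hF with hG | ⟨x, hx, hxP, hF⟩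
        · exact (hG.mono (subset_insert _ _)).forces _
        · have hlen := length_hist sA sB j
          have H : good (hist sA sB j) (sA (hist sA sB j)) :=
            sA_good _ ⟨x, hx, hxP, by rw [hlen, hd']; exact hF⟩
          have := H.2.2 (sB (hist sA sB j) (sA (hist sA sB j))) (hB _ _).1 (hB _ _).2
          rwa [hlen] at this
    have := key N le_rfl
    rwa [Nat.sub_self] at this

theorem ESO_le_of_forces {m k N : ℕ} (h : Forces m k N ∅) : ESO m k ≤ N :=
  Nat.sInf_le h.exists_strategy

/-- `b` lies strictly above and to the right of `a`. -/
def NE (a b : Pt) : Prop := a.1 < b.1 ∧ a.2 < b.2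

theorem hasUpRun_of_pairwise {P : Set Pt} {C : List Pt} {m : ℕ} (hC : C.Pairwise NE)
    (hP : ∀ c ∈ C, c ∈ P) (hm : m ≤ C.length) : HasUpRun P m := by
  have hlt : ∀ i j : Fin m, i < j → NE (C.get (i.castLE hm)) (C.get (j.castLE hm)) :=
    fun i j hij => List.pairwise_iff_get.1 hC _ _ hij
  refine ⟨fun i => C.get (i.castLE hm), fun i => hP _ (List.get_mem _ _),
    fun i j hij => (hlt i j hij).1, fun i j hij => ?_⟩
  rcases hij.eq_or_lt with rfl | hij
  · exact le_rfl
  · exact (hlt i j hij).2.le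

theorem hasDownRun_three {P : Set Pt} {a b c : Pt} (ha : a ∈ P) (hb : b ∈ P) (hc : c ∈ P)
    (hab : a.1 < b.1) (hbc : b.1 < c.1) (hab' : b.2 < a.2) (hbc' : c.2 < b.2) :
    HasDownRun P 3 := by
  refine ⟨![a, b, c], ?_, ?_, ?_⟩
  · intro i
    fin_cases i <;> simpa
  · rw [Fin.strictMono_iff_lt_succ]
    intro i
    fin_cases i <;> simpa
  · rw [Fin.strictAnti_iff_succ_lt]
    intro i
    fin_cases i <;> simpa

theorem exists_split_of_pairwise {C : List Pt} (hC : C.Pairwise NE) {y : ℝ}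
    (hy : ∀ c ∈ C, y ≠ c.2) :
    ∃ S T, C = S ++ T ∧ (∀ c ∈ S, c.2 < y) ∧ ∀ c ∈ T, y < c.2 := by
  induction C with
  | nil => exact ⟨[], [], by simp⟩
  | cons a C ih =>
    rw [List.pairwise_cons] at hC
    rcases lt_or_gt_of_ne (hy a (by simp)) with h | h
    · refine ⟨[], a :: C, rfl, by simp, fun c hc => ?_⟩
      rcases List.mem_cons.1 hc with rfl | hc
      · exact h
      · exact h.trans (hC.1 c hc).2
    · obtain ⟨S, T, rfl, hS, hT⟩ := ih hC.2 fun c hc => hy c (List.mem_cons_of_mem _ hc)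
      refine ⟨a :: S, T, rfl, fun c hc => ?_, hT⟩
      rcases List.mem_cons.1 hc with rfl | hc
      · exact h
      · exact hS c hc

/-- A point played to the right of the abscissa `L` cannot be below `a` without completing a
`3`-down-run. -/
def FloorAt (P : Set Pt) (L : ℝ) (a : Pt) : Prop :=
  ∃ l ∈ P, ∃ d ∈ P, a.2 ≤ l.2 ∧ l.1 ≤ L ∧ d.1 < l.1 ∧ l.2 < d.2

/-- A point played to the left of the abscissa `R` cannot be above `b` without completing a
`3`-down-run. -/
def CeilAt (P : Set Pt) (R : ℝ) (b : Pt) : Prop :=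
  ∃ u ∈ P, ∃ d ∈ P, u.2 ≤ b.2 ∧ R ≤ u.1 ∧ u.1 < d.1 ∧ d.2 < u.2

theorem FloorAt.mono {P Q : Set Pt} {L L' : ℝ} {a : Pt} (h : FloorAt P L a) (hPQ : P ⊆ Q)
    (hL : L ≤ L') : FloorAt Q L' a := by
  obtain ⟨l, hl, d, hd, h1, h2, h3⟩ := h
  exact ⟨l, hPQ hl, d, hPQ hd, h1, h2.trans hL, h3⟩

theorem CeilAt.mono {P Q : Set Pt} {R R' : ℝ} {b : Pt} (h : CeilAt P R b) (hPQ : P ⊆ Q)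
    (hR : R' ≤ R) : CeilAt Q R' b := by
  obtain ⟨u, hu, d, hd, h1, h2, h3⟩ := h
  exact ⟨u, hPQ hu, d, hPQ hd, h1, hR.trans h2, h3⟩

theorem FloorAt.lt {P : Set Pt} {L x y : ℝ} {a : Pt} (h : FloorAt P L a) (hx : L < x)
    (hy : ∀ p ∈ P, y ≠ p.2) (hD : ¬ HasDownRun (insert (x, y) P) 3) : a.2 < y := by
  obtain ⟨l, hl, d, hd, h1, h2, h3, h4⟩ := h
  by_contra! hya
  exact hD (hasDownRun_three (mem_insert_of_mem _ hd) (mem_insert_of_mem _ hl)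
    (mem_insert _ _) h3 (h2.trans_lt hx) h4 (lt_of_le_of_ne (hya.trans h1) (hy l hl)))

theorem CeilAt.lt {P : Set Pt} {R x y : ℝ} {b : Pt} (h : CeilAt P R b) (hx : x < R)
    (hy : ∀ p ∈ P, y ≠ p.2) (hD : ¬ HasDownRun (insert (x, y) P) 3) : y < b.2 := by
  obtain ⟨u, hu, d, hd, h1, h2, h3, h4⟩ := h
  by_contra! hyb
  exact hD (hasDownRun_three (mem_insert _ _) (mem_insert_of_mem _ hu)
    (mem_insert_of_mem _ hd) (hx.trans_le h2) h3
    (lt_of_le_of_ne (h1.trans hyb) (hy u hu).symm) h4)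

/-- A chain `Z ++ K ++ B` of played points whose part `K` lies over the open interval `(L, R)`,
such that points played over `(L, R)` are forced to lie between `Z` and `B`. -/
structure Slot (P : Set Pt) (L R : ℝ) (Z K B : List Pt) : Prop where
  finite : P.Finite
  sub : ∀ c ∈ Z ++ K ++ B, c ∈ P
  chain : (Z ++ K ++ B).Pairwise NE
  floor : ∀ z ∈ Z, FloorAt P L z
  ceil : ∀ b ∈ B, CeilAt P R b
  left_nonneg : 0 ≤ L
  right_le : R ≤ 1
  lt : L < R
  le_left : ∀ z ∈ Z, z.1 ≤ L
  right_le_of_mem : ∀ b ∈ B, R ≤ b.1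
  mem_Ioo : ∀ c ∈ K, c.1 ∈ Ioo L R

namespace Slot

variable {P : Set Pt} {L R : ℝ} {Z K B : List Pt}

theorem forces_of_le (h : Slot P L R Z K B) {m : ℕ} (hm : m ≤ Z.length + K.length + B.length)
    (n : ℕ) : Forces m 3 n P :=
  RunGoal.forces (Or.inl (hasUpRun_of_pairwise h.chain h.sub (by simp; omega))) n

theorem insert (h : Slot P L R Z K B) (p : Pt) : Slot (insert p P) L R Z K B :=
  { h with
    finite := h.finite.insert p
    sub := fun c hc => mem_insert_of_mem _ (h.sub c hc)
    floor := fun z hz => (h.floor z hz).mono (subset_insert _ _) le_rfl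
    ceil := fun b hb => (h.ceil b hb).mono (subset_insert _ _) le_rfl }

/-- An inversion `(t, q)` turns the part of the chain from `t` on into a ceiling. -/
theorem shrink_right {S T : List Pt} {t q : Pt} (h : Slot P L R Z (S ++ t :: T) B) (hq : q ∈ P)
    (hx : t.1 < q.1) (hy : q.2 < t.2) : Slot P L t.1 Z S (t :: T ++ B) := by
  obtain ⟨h1, h2, h3, h4, h5, h6, h7, h8, h9, h10, h11⟩ := h
  have ht := h11 t (by simp)
  have hT : ∀ b ∈ T, NE t b := by
    simp only [List.pairwise_append, List.pairwise_cons] at h3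
    exact h3.1.2.1.2.1.1
  have hS : ∀ b ∈ S, NE b t := by
    simp only [List.pairwise_append, List.pairwise_cons] at h3
    exact fun b hb => h3.1.2.1.2.2 b hb t (by simp)
  refine ⟨h1, by simpa using h2, by simpa using h3, h4, ?_, h6, ht.2.le.trans h7, ht.1, h9, ?_, ?_⟩
  · intro b hb
    rcases List.mem_append.1 hb with hb | hb
    · refine ⟨t, h2 t (by simp), q, hq, ?_, le_rfl, hx, hy⟩
      rcases List.mem_cons.1 hb with rfl | hb
      · exact le_rfl
      · exact (hT b hb).2.le
    · exact (h5 b hb).mono subset_rfl ht.2.le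
  · intro b hb
    rcases List.mem_append.1 hb with hb | hb
    · rcases List.mem_cons.1 hb with rfl | hb
      · exact le_rfl
      · exact (hT b hb).1.le
    · exact ht.2.le.trans (h10 b hb)
  · exact fun c hc => ⟨(h11 c (by simp [hc])).1, (hS c hc).1⟩

theorem sublist {K' : List Pt} (h : Slot P L R Z K B) (hK : K'.Sublist K) :
    Slot P L R Z K' B :=
  have hs : (Z ++ K' ++ B).Sublist (Z ++ K ++ B) := (hK.append_left Z).append_right B
  { h with
    sub := fun c hc => h.sub c (hs.subset hc)
    chain := h.chain.sublist hs
    mem_Ioo := fun c hc => h.mem_Ioo c (hK.subset hc) }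

theorem insert_middle {K₁ K₂ : List Pt} {x y : ℝ} (h : Slot P L R Z (K₁ ++ K₂) B)
    (hx : x ∈ Ioo L R) (h₁ : ∀ c ∈ K₁, NE c (x, y)) (h₂ : ∀ c ∈ K₂, NE (x, y) c)
    (hy : ∀ p ∈ P, y ≠ p.2) (hD : ¬ HasDownRun (Insert.insert (x, y) P) 3) :
    Slot (Insert.insert (x, y) P) L R Z (K₁ ++ (x, y) :: K₂) B := by
  have hZ : ∀ c ∈ Z, NE c (x, y) := fun c hc =>
    ⟨(h.le_left c hc).trans_lt hx.1, (h.floor c hc).lt hx.1 hy hD⟩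
  have hB : ∀ c ∈ B, NE (x, y) c := fun c hc =>
    ⟨hx.2.trans_le (h.right_le_of_mem c hc), (h.ceil c hc).lt hx.2 hy hD⟩
  have h' := h.insert (x, y)
  refine { h' with sub := fun c hc => ?_, chain := ?_, mem_Ioo := fun c hc => ?_ }
  · have := h'.sub c
    simp only [List.mem_append, List.mem_cons] at hc this
    rcases hc with (hc | hc | rfl | hc) | hc
    · exact this (by tauto)
    · exact this (by tauto)
    · exact mem_insert _ _
    · exact this (by tauto)
    · exact this (by tauto)
  · have := h.chain
    simp only [List.pairwise_append, List.pairwise_cons, List.mem_append, List.mem_cons] at this ⊢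
    grind
  · have := h.mem_Ioo c
    simp only [List.mem_append, List.mem_cons] at hc this
    rcases hc with hc | rfl | hc
    · exact this (Or.inl hc)
    · exact hx
    · exact this (Or.inr hc)

end Slot

/-- The half-turn of the unit square. -/
def rot (p : Pt) : Pt := (1 - p.1, 1 - p.2)

@[simp] theorem rot_rot (p : Pt) : rot (rot p) = p := by simp [rot]

theorem image_rot_image_rot (P : Set Pt) : rot '' (rot '' P) = P := by
  simp [image_image]

theorem HasUpRun.rot {P : Set Pt} {m : ℕ} (h : HasUpRun P m) : HasUpRun (rot '' P) m := by
  obtain ⟨f, hf, hx, hy⟩ := h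
  refine ⟨fun i => _root_.rot (f i.rev), fun i => mem_image_of_mem _ (hf _), fun i j hij => ?_,
    fun i j hij => ?_⟩
  · exact sub_lt_sub_left (hx (Fin.rev_lt_rev.2 hij)) 1
  · exact sub_le_sub_left (hy (Fin.rev_le_rev.2 hij)) 1

theorem HasDownRun.rot {P : Set Pt} {m : ℕ} (h : HasDownRun P m) : HasDownRun (rot '' P) m := by
  obtain ⟨f, hf, hx, hy⟩ := h
  refine ⟨fun i => _root_.rot (f i.rev), fun i => mem_image_of_mem _ (hf _), fun i j hij => ?_,
    fun i j hij => ?_⟩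
  · exact sub_lt_sub_left (hx (Fin.rev_lt_rev.2 hij)) 1
  · exact sub_lt_sub_left (hy (Fin.rev_lt_rev.2 hij)) 1

theorem Forces.rot {m k n : ℕ} {P : Set Pt} (h : Forces m k n P) : Forces m k n (rot '' P) := by
  induction n generalizing P with
  | zero => exact h.imp HasUpRun.rot HasDownRun.rot
  | succ n ih =>
    refine h.imp (Or.imp HasUpRun.rot HasDownRun.rot) ?_
    rintro ⟨x, hx, hxP, H⟩
    refine ⟨1 - x, ⟨by linarith [hx.2], by linarith [hx.1]⟩, ?_, fun y hy hyP => ?_⟩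
    · rintro _ ⟨p, hp, rfl⟩ h
      exact hxP p hp (sub_right_injective h)
    · have := ih (H (1 - y) ⟨by linarith [hy.2], by linarith [hy.1]⟩ fun p hp h =>
        hyP _ (mem_image_of_mem _ hp) (by simp [_root_.rot, ← h]))
      rw [image_insert_eq] at this
      simpa [_root_.rot] using this

theorem Forces.of_rot {m k n : ℕ} {P : Set Pt} (h : Forces m k n (_root_.rot '' P)) :
    Forces m k n P := by
  simpa only [image_rot_image_rot] using h.rot

theorem HasDownRun.of_rot {m : ℕ} {P : Set Pt} (h : HasDownRun (_root_.rot '' P) m) :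
    HasDownRun P m := by
  simpa only [image_rot_image_rot] using h.rot

/-- The half-turn of a chain, listed from left to right. -/
def rotList (l : List Pt) : List Pt := (l.map rot).reverse

@[simp] theorem rotList_nil : rotList [] = [] := rfl

@[simp] theorem rotList_cons (a : Pt) (l : List Pt) : rotList (a :: l) = rotList l ++ [rot a] := by
  simp [rotList]

@[simp] theorem rotList_append (l l' : List Pt) :
    rotList (l ++ l') = rotList l' ++ rotList l := by
  simp [rotList]

@[simp] theorem length_rotList (l : List Pt) : (rotList l).length = l.length := by
  simp [rotList]

@[simp] theorem rotList_rotList (l : List Pt) : rotList (rotList l) = l := by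
  simp [rotList, Function.comp_def]

theorem forall_mem_rotList {l : List Pt} {p : Pt → Prop} :
    (∀ c ∈ rotList l, p c) ↔ ∀ c ∈ l, p (rot c) := by
  simp only [rotList, List.mem_reverse, List.forall_mem_map]

theorem FloorAt.rot {P : Set Pt} {L : ℝ} {a : Pt} (h : FloorAt P L a) :
    CeilAt (rot '' P) (1 - L) (rot a) := by
  obtain ⟨l, hl, d, hd, h1, h2, h3, h4⟩ := h
  exact ⟨_, mem_image_of_mem _ hl, _, mem_image_of_mem _ hd, sub_le_sub_left h1 1,
    sub_le_sub_left h2 1, sub_lt_sub_left h3 1, sub_lt_sub_left h4 1⟩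

theorem CeilAt.rot {P : Set Pt} {R : ℝ} {b : Pt} (h : CeilAt P R b) :
    FloorAt (rot '' P) (1 - R) (rot b) := by
  obtain ⟨u, hu, d, hd, h1, h2, h3, h4⟩ := h
  exact ⟨_, mem_image_of_mem _ hu, _, mem_image_of_mem _ hd, sub_le_sub_left h1 1,
    sub_le_sub_left h2 1, sub_lt_sub_left h3 1, sub_lt_sub_left h4 1⟩

namespace Slot

variable {P : Set Pt} {L R : ℝ} {Z K B : List Pt}

theorem rot (h : Slot P L R Z K B) :
    Slot (rot '' P) (1 - R) (1 - L) (rotList B) (rotList K) (rotList Z) := by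
  have hl : rotList B ++ rotList K ++ rotList Z = rotList (Z ++ K ++ B) := by simp
  refine ⟨h.finite.image _, ?_, ?_, ?_, ?_, ?_, ?_, ?_, ?_, ?_, ?_⟩
  · rw [hl, forall_mem_rotList]
    exact fun c hc => mem_image_of_mem _ (h.sub c hc)
  · rw [hl, rotList, List.pairwise_reverse, List.pairwise_map]
    exact h.chain.imp fun hab => ⟨sub_lt_sub_left hab.1 1, sub_lt_sub_left hab.2 1⟩
  · exact forall_mem_rotList.2 fun c hc => (h.ceil c hc).rot
  · exact forall_mem_rotList.2 fun c hc => (h.floor c hc).rot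
  · linarith [h.right_le]
  · linarith [h.left_nonneg]
  · linarith [h.lt]
  · exact forall_mem_rotList.2 fun c hc => sub_le_sub_left (h.right_le_of_mem c hc) 1
  · exact forall_mem_rotList.2 fun c hc => sub_le_sub_left (h.le_left c hc) 1
  · exact forall_mem_rotList.2 fun c hc =>
      ⟨sub_lt_sub_left (h.mem_Ioo c hc).2 1, sub_lt_sub_left (h.mem_Ioo c hc).1 1⟩

/-- An inversion `(q, t)` turns the part of the chain up to `t` into a floor. -/
theorem shrink_left {S T : List Pt} {t q : Pt} (h : Slot P L R Z (S ++ t :: T) B) (hq : q ∈ P)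
    (hx : q.1 < t.1) (hy : t.2 < q.2) : Slot P t.1 R (Z ++ (S ++ [t])) T B := by
  have h' : Slot (_root_.rot '' P) (1 - R) (1 - L) (rotList B)
      (rotList T ++ _root_.rot t :: rotList S) (rotList Z) := by
    simpa using h.rot
  have := (h'.shrink_right (mem_image_of_mem _ hq) (sub_lt_sub_left hx 1)
    (sub_lt_sub_left hy 1)).rot
  have ht : 1 - (_root_.rot t).1 = t.1 := by simp [_root_.rot]
  simpa [image_rot_image_rot, ht] using this

theorem pairwise_middle (h : Slot P L R Z K B) : K.Pairwise NE :=
  h.chain.sublist (by simp)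

theorem lt_of_mem_left {S T : List Pt} {t : Pt} (h : Slot P L R Z (S ++ t :: T) B) :
    ∀ c ∈ S, NE c t := fun c hc =>
  (List.pairwise_append.1 h.pairwise_middle).2.2 c hc t (by simp)

theorem lt_of_mem_right {S T : List Pt} {t : Pt} (h : Slot P L R Z (S ++ t :: T) B) :
    ∀ c ∈ T, NE t c :=
  (List.pairwise_cons.1 (List.pairwise_append.1 h.pairwise_middle).2.1).1

theorem exists_shrink_right {S T U : List Pt} {q : Pt} (h : Slot P L R Z (S ++ (T ++ U)) B)
    (hT : T ≠ []) (hq : q ∈ P) (hx : ∀ t ∈ T, t.1 < q.1) (hy : ∀ t ∈ T, q.2 < t.2) :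
    ∃ R' ≤ q.1, Slot P L R' Z S (T ++ U ++ B) := by
  obtain ⟨t, T, rfl⟩ := List.exists_cons_of_ne_nil hT
  exact ⟨t.1, (hx t (by simp)).le, h.shrink_right hq (hx t (by simp)) (hy t (by simp))⟩

theorem forces_succ (h : Slot P L R Z K B) {m n : ℕ} {a b : ℝ} (ha : L ≤ a) (hb : b ≤ R)
    (hab : a < b)
    (H : ∀ x ∈ Ioo a b, ∀ y, (∀ p ∈ P, y ≠ p.2) →
      ¬ HasDownRun (Insert.insert (x, y) P) 3 → Forces m 3 n (Insert.insert (x, y) P)) :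
    Forces m 3 (n + 1) P := by
  obtain ⟨x, hx, hxP⟩ := exists_fresh h.finite hab
  refine Or.inr ⟨x, ⟨(h.left_nonneg.trans ha).trans_lt hx.1, hx.2.trans_le (hb.trans h.right_le)⟩,
    hxP, fun y _ hyP => ?_⟩
  by_cases hD : HasDownRun (Insert.insert (x, y) P) 3
  · exact RunGoal.forces (Or.inr hD) n
  · exact H x hx y hyP hD

/-- Over an empty slot enclosed by an inversion, every further point extends the chain. -/
theorem forces_of_enclosed {m n : ℕ} {p q : Pt} (h : Slot P L R Z [] B) (hp : p ∈ P)
    (hq : q ∈ P) (hpL : p.1 ≤ L) (hRq : R ≤ q.1) (hqp : q.2 < p.2)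
    (hm : m ≤ Z.length + B.length + n) : Forces m 3 n P := by
  induction n generalizing P L R Z B with
  | zero => exact h.forces_of_le (by simpa using hm) 0
  | succ n ih =>
    refine h.forces_succ le_rfl le_rfl h.lt fun x hx y hy hD => ?_
    have h' : Slot (Insert.insert (x, y) P) L R Z ([] ++ (x, y) :: []) B :=
      insert_middle (K₁ := []) (K₂ := []) h hx (by simp) (by simp) hy hD
    have hp' := mem_insert_of_mem (x, y) hp
    have hq' := mem_insert_of_mem (x, y) hq
    rcases lt_or_gt_of_ne (hy p hp) with hyp | hyp
    · exact ih (h'.shrink_left hp' (hpL.trans_lt hx.1) hyp) hp' hq' (hpL.trans hx.1.le) hRq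
        (by simp; omega)
    · exact ih (h'.shrink_right hq' (hx.2.trans_le hRq) (hqp.trans hyp)) hp' hq' hpL
        (hx.2.le.trans hRq) (by simp; omega)

/-- Over a slot whose last point forms an inversion with a point to the right of the slot. -/
theorem forces_of_inversion_right {m n r : ℕ} {p q : Pt} (h : Slot P L R Z (K ++ [p]) B)
    (hq : q ∈ P) (hRq : R ≤ q.1) (hqp : q.2 < p.2) (hK : K.length + 1 ≤ (r + 1).choose 2)
    (hm : m + r ≤ n + (Z.length + (K.length + 1) + B.length)) : Forces m 3 n P := by
  induction n generalizing P L R Z K B r p q with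
  | zero => exact h.forces_of_le (by simp; omega) 0
  | succ n ih =>
    obtain ⟨s, rfl⟩ : ∃ s, r = s + 1 := by
      refine Nat.exists_eq_succ_of_ne_zero ?_
      rintro rfl
      simp at hK
    have hpI := h.mem_Ioo p (by simp)
    have hpP := h.sub p (by simp)
    have hKp := h.lt_of_mem_left
    refine h.forces_succ hpI.1.le le_rfl hpI.2 fun x hx y hy hD => ?_
    have hxI : x ∈ Ioo L R := ⟨hpI.1.trans hx.1, hx.2⟩
    have hqP := mem_insert_of_mem (x, y) hq
    rcases lt_or_gt_of_ne (hy p hpP) with hyp | hyp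
    · obtain ⟨S, T, rfl, hS, hT⟩ := exists_split_of_pairwise
        (List.pairwise_append.1 h.pairwise_middle).1 fun c hc => hy c (h.sub c (by simp [hc]))
      simp only [List.length_append] at hK hm
      by_cases hTr : T.length + 1 ≤ s + 1
      · have h' := insert_middle (K₁ := S) (K₂ := []) (h.sublist (by simp)) hxI
          (fun c hc => ⟨(hKp c (by simp [hc])).1.trans hx.1, hS c hc⟩) (by simp) hy hD
        exact (h'.shrink_left (mem_insert_of_mem _ hpP) hx.1 hyp).forces_of_enclosed
          (mem_insert_of_mem _ hpP) hqP hx.1.le hRq hqp (by simp; omega)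
      · rcases T with _ | ⟨c, T⟩
        · exact absurd (Nat.succ_le_succ s.zero_le) hTr
        · simp only [List.length_cons] at hTr hK hm
          have hTx : ∀ t ∈ T ++ [p], t.1 < x := by
            rw [List.forall_mem_append, List.forall_mem_singleton]
            exact ⟨fun t ht => (hKp t (by simp [ht])).1.trans hx.1, hx.1⟩
          have hTy : ∀ t ∈ T ++ [p], y < t.2 := by
            rw [List.forall_mem_append, List.forall_mem_singleton]
            exact ⟨fun t ht => hT t (by simp [ht]), hyp⟩
          obtain ⟨R', hR', h'⟩ := exists_shrink_right (S := S ++ [c]) (T := T ++ [p]) (U := [])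
            (q := (x, y)) (by simpa using h.insert (x, y)) (by simp) (mem_insert _ _) hTx hTy
          refine ih h' (mem_insert _ _) hR' (hT c (by simp)) (r := s) ?_ ?_
          · have := Nat.choose_succ_succ (s + 1) 1
            simp only [Nat.succ_eq_add_one, Nat.choose_one_right, Nat.reduceAdd] at this
            omega
          · simp only [List.length_append, List.length_cons, List.length_nil]
            omega
    · have h' := insert_middle (K₁ := K ++ [p]) (K₂ := []) (by simpa using h) hxI
        (fun c hc => ?_) (by simp) hy hD
      · exact ih (h'.shrink_right hqP (hx.2.trans_le hRq) (hqp.trans hyp)) hqP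
          (hx.2.le.trans hRq) hqp hK (by simp; omega)
      · rcases List.mem_append.1 hc with hc | hc
        · exact ⟨(hKp c hc).1.trans hx.1, (hKp c hc).2.trans hyp⟩
        · obtain rfl := List.mem_singleton.1 hc
          exact ⟨hx.1, hyp⟩

/-- Over a slot whose first point forms an inversion with a point to the left of the slot. -/
theorem forces_of_inversion_left {m n r : ℕ} {p q : Pt} (h : Slot P L R Z (q :: K) B)
    (hp : p ∈ P) (hpL : p.1 ≤ L) (hqp : q.2 < p.2) (hK : K.length + 1 ≤ (r + 1).choose 2)
    (hm : m + r ≤ n + (Z.length + (K.length + 1) + B.length)) : Forces m 3 n P := by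
  have h' : Slot (_root_.rot '' P) (1 - R) (1 - L) (rotList B) (rotList K ++ [_root_.rot q])
      (rotList Z) := by
    simpa using h.rot
  exact Forces.of_rot (h'.forces_of_inversion_right (mem_image_of_mem _ hp)
    (sub_le_sub_left hpL 1) (sub_lt_sub_left hqp 1) (by simpa using hK) (by simp; omega))

/-- The reply `(x, y)` between the points `p` and `q` of an inversion, below `q`. -/
theorem forces_insert_of_lt {m n r : ℕ} {J₁ J₂ : List Pt} {p q : Pt} {x y : ℝ}
    (hp : Slot P L R Z (J₁ ++ p :: J₂) B) (hq : Slot P L R Z (J₁ ++ q :: J₂) B)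
    (hqp : q.2 < p.2) (hx : x ∈ Ioo p.1 q.1) (hy : ∀ c ∈ P, y ≠ c.2)
    (hD : ¬ HasDownRun (Insert.insert (x, y) P) 3) (hyq : y < q.2)
    (hJ₁ : J₁.length + 1 ≤ r.choose 2) (hJ₂ : J₂.length + 1 ≤ r.choose 2)
    (hm : m + r ≤ n + 1 + (Z.length + (J₁.length + 1 + J₂.length) + B.length)) :
    Forces m 3 n (Insert.insert (x, y) P) := by
  have hpP := hp.sub p (by simp)
  have hpJ₁ := hp.lt_of_mem_left
  have hqJ₂ := hq.lt_of_mem_right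
  have hxI : x ∈ Ioo L R :=
    ⟨(hp.mem_Ioo p (by simp)).1.trans hx.1, hx.2.trans (hq.mem_Ioo q (by simp)).2⟩
  obtain ⟨S, T, rfl, hS, hT⟩ := exists_split_of_pairwise
    (List.pairwise_append.1 hp.pairwise_middle).1 fun c hc => hy c (hp.sub c (by simp [hc]))
  rcases T with _ | ⟨c, T⟩
  · simp only [List.append_nil] at *
    have h' := insert_middle (K₁ := S) (K₂ := q :: J₂) hq hxI
      (fun c hc => ⟨(hpJ₁ c hc).1.trans hx.1, hS c hc⟩)
      (fun c hc => ?_) hy hD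
    · refine (h'.shrink_left (mem_insert_of_mem _ hpP) hx.1 (hyq.trans hqp)
        ).forces_of_inversion_left (r := r) (mem_insert_of_mem _ hpP) hx.1.le hqp ?_ ?_
      · exact hJ₂.trans (Nat.choose_le_choose 2 r.le_succ)
      · simp
        omega
    · rcases List.mem_cons.1 hc with rfl | hc
      · exact ⟨hx.2, hyq⟩
      · exact ⟨hx.2.trans (hqJ₂ c hc).1, hyq.trans (hqJ₂ c hc).2⟩
  · obtain ⟨s, rfl⟩ : ∃ s, r = s + 1 := by
      refine Nat.exists_eq_succ_of_ne_zero ?_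
      rintro rfl
      simp at hJ₁
    have hTx : ∀ t ∈ T ++ [p], t.1 < x := by
      rw [List.forall_mem_append, List.forall_mem_singleton]
      exact ⟨fun t ht => (hpJ₁ t (by simp [ht])).1.trans hx.1, hx.1⟩
    have hTy : ∀ t ∈ T ++ [p], y < t.2 := by
      rw [List.forall_mem_append, List.forall_mem_singleton]
      exact ⟨fun t ht => hT t (by simp [ht]), hyq.trans hqp⟩
    obtain ⟨R', hR', h'⟩ := exists_shrink_right (S := S ++ [c]) (T := T ++ [p]) (U := J₂)
      (q := (x, y)) (by simpa using hp.insert (x, y)) (by simp) (mem_insert _ _) hTx hTy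
    simp only [List.length_append, List.length_cons] at hJ₁ hm
    refine h'.forces_of_inversion_right (r := s) (mem_insert _ _) hR' (hT c (by simp)) ?_ ?_
    · omega
    · simp only [List.length_append, List.length_cons, List.length_nil]
      omega

/-- Over a slot containing both points of an inversion, which are interchangeable as members of
the chain. -/
theorem forces_of_inversion {m n r : ℕ} {J₁ J₂ : List Pt} {p q : Pt}
    (hp : Slot P L R Z (J₁ ++ p :: J₂) B) (hq : Slot P L R Z (J₁ ++ q :: J₂) B)
    (hpq : p.1 < q.1) (hqp : q.2 < p.2)
    (hJ₁ : J₁.length + 1 ≤ r.choose 2) (hJ₂ : J₂.length + 1 ≤ r.choose 2)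
    (hm : m + r ≤ n + (Z.length + (J₁.length + 1 + J₂.length) + B.length)) :
    Forces m 3 n P := by
  rcases n with _ | n
  · exact hp.forces_of_le (by simp; omega) 0
  have hpP := hp.sub p (by simp)
  have hqP := hq.sub q (by simp)
  refine hp.forces_succ (hp.mem_Ioo p (by simp)).1.le (hq.mem_Ioo q (by simp)).2.le hpq
    fun x hx y hy hD => ?_
  rcases lt_or_gt_of_ne (hy q hqP) with hyq | hyq
  · exact hp.forces_insert_of_lt hq hqp hx hy hD hyq hJ₁ hJ₂ hm
  have hyp : p.2 < y := by
    by_contra! hyp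
    exact hD (hasDownRun_three (mem_insert_of_mem _ hpP) (mem_insert _ _)
      (mem_insert_of_mem _ hqP) hx.1 hx.2 (lt_of_le_of_ne hyp (hy p hpP)) hyq)
  have hp' := hp.rot
  have hq' := hq.rot
  simp only [rotList_append, rotList_cons, List.append_assoc, List.singleton_append] at hp' hq'
  refine Forces.of_rot ?_
  rw [image_insert_eq]
  refine hq'.forces_insert_of_lt (x := 1 - x) (y := 1 - y) hp' (sub_lt_sub_left hqp 1)
    ⟨sub_lt_sub_left hx.2 1, sub_lt_sub_left hx.1 1⟩ ?_ ?_ (sub_lt_sub_left hyp 1)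
    (by simpa using hJ₂) (by simpa using hJ₁) (by simp; omega)
  · rintro _ ⟨c, hc, rfl⟩ h
    exact hy c hc (sub_right_injective h)
  · intro h
    exact hD (HasDownRun.of_rot (by rwa [image_insert_eq]))

/-- The reply `(x, y)` to a move splitting the middle part of a slot evenly, below some point
to its left. -/
theorem forces_insert_of_break {m n r : ℕ} {K₁ K₂ : List Pt} {x y : ℝ}
    (ih : ∀ {P : Set Pt} {L R : ℝ} {Z K B : List Pt} {r : ℕ}, Slot P L R Z K B →
      m + r ≤ n + (Z.length + K.length + B.length) →
      m ≤ Z.length + B.length + r + r.choose 3 → Forces m 3 n P)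
    (h : Slot P L R Z (K₁ ++ K₂) B) (hx : x ∈ Ioo L R) (h₁ : ∀ c ∈ K₁, c.1 < x)
    (h₂ : ∀ c ∈ K₂, x < c.1) (hy : ∀ c ∈ P, y ≠ c.2)
    (hD : ¬ HasDownRun (Insert.insert (x, y) P) 3) (hyK : ∃ c ∈ K₁, y < c.2)
    (hlen₁ : K₁.length ≤ K₂.length + 1) (hlen₂ : K₂.length ≤ K₁.length + 1)
    (hm : m + r ≤ n + 1 + (Z.length + (K₁.length + K₂.length) + B.length))
    (hr : m ≤ Z.length + B.length + r + r.choose 3) :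
    Forces m 3 n (Insert.insert (x, y) P) := by
  have h' := h.insert (x, y)
  rcases r with _ | r
  · exact h'.forces_of_le (by simp at hr; omega) n
  have hr3 : (r + 1).choose 3 = r.choose 2 + r.choose 3 := Nat.choose_succ_succ r 2
  have hr2 : r.choose 2 ≤ (r + 1).choose 2 := Nat.choose_le_choose 2 r.le_succ
  obtain ⟨S, T, rfl, hS, hT⟩ := exists_split_of_pairwise
    (List.pairwise_append.1 h.pairwise_middle).1 fun c hc => hy c (h.sub c (by simp [hc]))
  rcases T with _ | ⟨c, T⟩
  · obtain ⟨c, hc, hyc⟩ := hyK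
    exact absurd (hS c (by simpa using hc)) hyc.not_gt
  simp only [List.append_assoc, List.cons_append] at h h'
  simp only [List.length_append, List.length_cons] at hlen₁ hlen₂ hm
  have hcx : c.1 < x := h₁ c (by simp)
  have hyc : y < c.2 := hT c (by simp)
  by_cases hA : T ≠ [] ∧ S.length + 1 ≤ r.choose 2
  · obtain ⟨R', hR', hs⟩ := exists_shrink_right (S := S ++ [c]) (T := T) (U := K₂)
      (q := (x, y)) (by simpa using h') hA.1 (mem_insert _ _)
      (fun t ht => h₁ t (by simp [ht])) (fun t ht => hT t (by simp [ht]))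
    refine hs.forces_of_inversion_right (r := r) (mem_insert _ _) hR' hyc (hA.2.trans hr2) ?_
    simp only [List.length_append]
    omega
  by_cases hB : T = [] ∧ S.length + 1 ≤ r.choose 2 ∧ K₂.length + 1 ≤ r.choose 2
  · obtain ⟨rfl, hB⟩ := hB
    have hq : Slot (Insert.insert (x, y) P) L R Z (S ++ (x, y) :: K₂) B :=
      insert_middle (h.sublist (by simp)) hx (fun a ha => ⟨h₁ a (by simp [ha]), hS a ha⟩)
        (fun a ha => ⟨h₂ a ha, hyc.trans (h.lt_of_mem_right a (by simpa using ha)).2⟩) hy hD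
    exact forces_of_inversion (p := c) (r := r) (by simpa using h') hq hcx hyc hB.1 hB.2
      (by simp at hm; omega)
  · refine ih (r := r) (h'.shrink_right (mem_insert _ _) hcx hyc) ?_ ?_
    · simp
      omega
    · simp only [List.length_append, List.length_cons]
      rcases T with _ | ⟨d, T⟩
      · simp_all
        omega
      · simp_all
        omega

theorem exists_Ioo_between {K₁ K₂ : List Pt} (h : Slot P L R Z (K₁ ++ K₂) B) :
    ∃ a b, L ≤ a ∧ a < b ∧ b ≤ R ∧ (∀ c ∈ K₁, c.1 ≤ a) ∧ ∀ c ∈ K₂, b ≤ c.1 := by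
  have hch := List.pairwise_append.1 h.pairwise_middle
  have hI := h.mem_Ioo
  rw [List.forall_mem_append] at hI
  obtain ⟨a, hLa, haK, ha⟩ : ∃ a, L ≤ a ∧ (∀ c ∈ K₁, c.1 ≤ a) ∧ (a = L ∨ ∃ c ∈ K₁, a = c.1) := by
    rcases List.eq_nil_or_concat K₁ with rfl | ⟨S, c, rfl⟩
    · exact ⟨L, le_rfl, by simp, Or.inl rfl⟩
    · refine ⟨c.1, (hI.1 c (by simp)).1.le, ?_, Or.inr ⟨c, by simp, rfl⟩⟩
      rw [List.concat_eq_append, List.forall_mem_append, List.forall_mem_singleton]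
      refine ⟨fun d hd => ?_, le_rfl⟩
      have hSc : (S ++ [c]).Pairwise NE := by simpa using hch.1
      exact ((List.pairwise_append.1 hSc).2.2 d hd c (by simp)).1.le
  obtain ⟨b, hbR, hbK, hb⟩ : ∃ b ≤ R, (∀ c ∈ K₂, b ≤ c.1) ∧ (b = R ∨ ∃ c ∈ K₂, b = c.1) := by
    rcases K₂ with _ | ⟨c, T⟩
    · exact ⟨R, le_rfl, by simp, Or.inl rfl⟩
    · refine ⟨c.1, (hI.2 c (by simp)).2.le, ?_, Or.inr ⟨c, by simp, rfl⟩⟩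
      rw [List.forall_mem_cons]
      exact ⟨le_rfl, fun d hd => ((List.pairwise_cons.1 hch.2.1).1 d hd).1.le⟩
  refine ⟨a, b, hLa, ?_, hbR, haK, hbK⟩
  rcases ha with rfl | ⟨c, hc, rfl⟩ <;> rcases hb with rfl | ⟨d, hd, rfl⟩
  · exact h.lt
  · exact (hI.2 d hd).1
  · exact (hI.1 c hc).2
  · exact (hch.2.2 c hc d hd).1

/-- Player A wins with `r` wasted points from a slot whose enclosing chains have at least
`m - r - r.choose 3` points. -/
theorem forces_of_le_choose {m n r : ℕ} (h : Slot P L R Z K B)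
    (hm : m + r ≤ n + (Z.length + K.length + B.length))
    (hr : m ≤ Z.length + B.length + r + r.choose 3) : Forces m 3 n P := by
  induction n generalizing P L R Z K B r with
  | zero => exact h.forces_of_le (by omega) 0
  | succ n ih =>
    obtain ⟨K₁, K₂, rfl, hlen₁, hlen₂⟩ : ∃ K₁ K₂, K = K₁ ++ K₂ ∧
        K₁.length ≤ K₂.length + 1 ∧ K₂.length ≤ K₁.length + 1 :=
      ⟨K.take (K.length / 2), K.drop (K.length / 2), (List.take_append_drop _ _).symm,
        by simp; omega, by simp; omega⟩
    obtain ⟨a, b, hLa, hab, hbR, haK, hbK⟩ := h.exists_Ioo_between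
    refine h.forces_succ hLa hbR hab fun x hx y hy hD => ?_
    have hxI : x ∈ Ioo L R := ⟨hLa.trans_lt hx.1, hx.2.trans_le hbR⟩
    have h₁ : ∀ c ∈ K₁, c.1 < x := fun c hc => (haK c hc).trans_lt hx.1
    have h₂ : ∀ c ∈ K₂, x < c.1 := fun c hc => hx.2.trans_le (hbK c hc)
    rw [List.length_append] at hm
    by_cases hK₁ : ∃ c ∈ K₁, y < c.2
    · exact forces_insert_of_break ih h hxI h₁ h₂ hy hD hK₁ hlen₁ hlen₂ hm hr
    by_cases hK₂ : ∃ c ∈ K₂, c.2 < y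
    · have h' := h.rot
      rw [rotList_append] at h'
      refine Forces.of_rot ?_
      rw [image_insert_eq]
      refine forces_insert_of_break (x := 1 - x) (y := 1 - y) (r := r) ih h'
        ⟨sub_lt_sub_left hxI.2 1, sub_lt_sub_left hxI.1 1⟩
        (forall_mem_rotList.2 fun c hc => sub_lt_sub_left (h₂ c hc) 1)
        (forall_mem_rotList.2 fun c hc => sub_lt_sub_left (h₁ c hc) 1) ?_ ?_ ?_
        (by simpa using hlen₂) (by simpa using hlen₁) (by simp; omega) (by simp; omega)
      · rintro _ ⟨c, hc, rfl⟩ h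
        exact hy c hc (sub_right_injective h)
      · intro h
        exact hD (HasDownRun.of_rot (by rwa [image_insert_eq]))
      · obtain ⟨c, hc, hcy⟩ := hK₂
        exact ⟨_root_.rot c, by simpa [rotList] using ⟨_, _, hc, rfl⟩, sub_lt_sub_left hcy 1⟩
    · push Not at hK₁ hK₂
      refine ih (r := r) (h.insert_middle hxI (fun c hc => ⟨h₁ c hc, ?_⟩)
        (fun c hc => ⟨h₂ c hc, ?_⟩) hy hD) (by simp; omega) hr
      · exact lt_of_le_of_ne (hK₁ c hc) (hy c (h.sub c (by simp [hc]))).symm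
      · exact lt_of_le_of_ne (hK₂ c hc) (hy c (h.sub c (by simp [hc])))

end Slot

theorem ESO_three_le {m r : ℕ} (h : m ≤ r + r.choose 3) : ESO m 3 ≤ m + r := by
  have h₀ : Slot ∅ 0 1 [] [] [] := by
    constructor <;> simp
  exact ESO_le_of_forces (h₀.forces_of_le_choose (r := r) (by simp) (by simpa using h))

theorem sub_two_pow_three_le (w : ℕ) : ((w : ℝ) - 2) ^ 3 ≤ 6 * (w + w.choose 3 : ℕ) := by
  rcases w with _ | _ | w
  · norm_num
  · norm_num [Nat.choose]
  have h : 6 * (w + 2).choose 3 = (w + 2) * (w + 1) * w := by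
    have := Nat.descFactorial_eq_factorial_mul_choose (w + 2) 3
    simp [Nat.descFactorial, Nat.factorial] at this
    linarith
  have h' : (6 : ℝ) * (w + 2).choose 3 = (w + 2) * (w + 1) * w := by exact_mod_cast h
  push_cast
  have hw : (0 : ℝ) ≤ w := w.cast_nonneg
  nlinarith [mul_nonneg hw hw, mul_nonneg (mul_nonneg hw hw) hw]

theorem ESO_m3_upper (m : ℕ) (hm : 3 ≤ m) :
    (ESO m 3 : ℝ) < m + (6 * (m : ℝ)) ^ ((1 : ℝ) / 3) + 3 := by
  have hex : ∃ r, m ≤ r + r.choose 3 := ⟨m, Nat.le_add_right _ _⟩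
  have hle := ESO_three_le (Nat.find_spec hex)
  have hmin := fun w => Nat.find_min hex (m := w)
  generalize Nat.find hex = r at hle hmin
  have hle' : (ESO m 3 : ℝ) ≤ m + r := by exact_mod_cast hle
  suffices (r : ℝ) - 3 < (6 * (m : ℝ)) ^ ((1 : ℝ) / 3) by linarith
  have hpos : (0 : ℝ) < 6 * m := by
    have : (3 : ℝ) ≤ m := by exact_mod_cast hm
    linarith
  rcases r with _ | w
  · have := Real.rpow_pos_of_pos hpos (1 / 3)
    push_cast
    linarith
  have hcube : ((6 * (m : ℝ)) ^ ((1 : ℝ) / 3)) ^ 3 = 6 * m := by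
    rw [← Real.rpow_mul_natCast hpos.le]
    norm_num
  have hw : ((w + w.choose 3 : ℕ) : ℝ) < m := by
    exact_mod_cast not_le.1 (hmin w w.lt_succ_self)
  have hsub := sub_two_pow_three_le w
  refine lt_of_pow_lt_pow_left₀ 3 (Real.rpow_nonneg hpos.le _) ?_
  have h3 : ((w + 1 : ℕ) : ℝ) - 3 = w - 2 := by
    push_cast
    ring
  rw [h3, hcube]
  linarith
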